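/- The collection of inversion sets of permutations of {1,…,n} that satisfy condition (I2)* is a sublattice of the permutation lattice Sₙ: it is closed under the meet and the join of Sₙ. Moreover, for two such sets the meet in Sₙ is their intersection and the join in Sₙ is the transitive closure of their union. -/

import Mathlib

/-- The inversion set of a permutation `σ` of `Fin n`: pairs `(a, b)` with `a > b`
such that `a` precedes `b` in the word `σ(1) σ(2) ⋯ σ(n)`, i.e. `σ⁻¹ a < σ⁻¹ b`. -/
def InvSet (n : ℕ) (σ : Equiv.Perm (Fin n)) : Set (Fin n × Fin n) :=
  {p | p.2 < p.1 ∧ σ.symm p.1 < σ.symm p.2}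

/-- `A` is the inversion set of some permutation of `Fin n`. -/
def IsInvSet (n : ℕ) (A : Set (Fin n × Fin n)) : Prop :=
  ∃ σ : Equiv.Perm (Fin n), A = InvSet n σ

/-- Condition (I1): `A` is transitive. -/
def CondI1 {n : ℕ} (A : Set (Fin n × Fin n)) : Prop :=
  ∀ a b c : Fin n, (a, b) ∈ A → (b, c) ∈ A → (a, c) ∈ A

/-- Condition (I2): if `b < c < a` and `(a, b) ∈ A`, then `(a, c) ∈ A` or `(c, b) ∈ A`. -/
def CondI2 {n : ℕ} (A : Set (Fin n × Fin n)) : Prop :=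
  ∀ a b c : Fin n, b < c → c < a → (a, b) ∈ A → (a, c) ∈ A ∨ (c, b) ∈ A

/-- Condition (I2)*: if `b < c < a` and `(a, b) ∈ A`, then `(c, b) ∈ A`. -/
def CondI2Star {n : ℕ} (A : Set (Fin n × Fin n)) : Prop :=
  ∀ a b c : Fin n, b < c → c < a → (a, b) ∈ A → (c, b) ∈ A

/-- A bracketing function on `Fin n`: (E1) `k ≤ E k`, and
(E2) if `k ≤ j ≤ E k` then `E j ≤ E k`. -/
def IsBracketing {n : ℕ} (E : Fin n → Fin n) : Prop :=
  (∀ k, k ≤ E k) ∧ ∀ k j, k ≤ j → j ≤ E k → E j ≤ E k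

/-- The set of pairs `I_E = {(a, k) : k < a ≤ E k}` associated to a bracketing function. -/
def IE {n : ℕ} (E : Fin n → Fin n) : Set (Fin n × Fin n) :=
  {p | p.2 < p.1 ∧ p.1 ≤ E p.2}

/-- The transitive closure of a set of pairs. -/
def TrCl {n : ℕ} (A : Set (Fin n × Fin n)) : Set (Fin n × Fin n) :=
  {p | Relation.TransGen (fun a b => (a, b) ∈ A) p.1 p.2}

theorem IsInvSet.lt {n : ℕ} {A : Set (Fin n × Fin n)} (hA : IsInvSet n A) {a b : Fin n}
    (h : (a, b) ∈ A) : b < a := by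
  obtain ⟨σ, rfl⟩ := hA
  exact h.1

theorem IsInvSet.condI1 {n : ℕ} {A : Set (Fin n × Fin n)} (hA : IsInvSet n A) : CondI1 A := by
  obtain ⟨σ, rfl⟩ := hA
  exact fun a b c hab hbc => ⟨hbc.1.trans hab.1, hab.2.trans hbc.2⟩

theorem CondI2Star.condI2 {n : ℕ} {A : Set (Fin n × Fin n)} (hA : CondI2Star A) : CondI2 A :=
  fun a b c hbc hca hab => Or.inr (hA a b c hbc hca hab)

theorem CondI2Star.union {n : ℕ} {A B : Set (Fin n × Fin n)} (hA : CondI2Star A)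
    (hB : CondI2Star B) : CondI2Star (A ∪ B) :=
  fun a b c hbc hca hab => hab.imp (hA a b c hbc hca) (hB a b c hbc hca)

theorem CondI2Star.inter {n : ℕ} {A B : Set (Fin n × Fin n)} (hA : CondI2Star A)
    (hB : CondI2Star B) : CondI2Star (A ∩ B) :=
  fun a b c hbc hca hab => ⟨hA a b c hbc hca hab.1, hB a b c hbc hca hab.2⟩

theorem subset_trCl {n : ℕ} (A : Set (Fin n × Fin n)) : A ⊆ TrCl A :=
  fun _ hp => Relation.TransGen.single hp

theorem condI1_trCl {n : ℕ} (A : Set (Fin n × Fin n)) : CondI1 (TrCl A) :=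
  fun _ _ _ hab hbc => Relation.TransGen.trans hab hbc

theorem CondI1.trCl_subset {n : ℕ} {A C : Set (Fin n × Fin n)} (hC : CondI1 C) (h : A ⊆ C) :
    TrCl A ⊆ C := by
  rintro ⟨a, b⟩ (hab : Relation.TransGen _ a b)
  induction hab with
  | single h' => exact h h'
  | tail _ h' ih => exact hC _ _ _ ih (h h')

theorem lt_of_mem_trCl {n : ℕ} {A : Set (Fin n × Fin n)} (hA : ∀ a b, (a, b) ∈ A → b < a)
    {a b : Fin n} (h : (a, b) ∈ TrCl A) : b < a := by
  have desc : CondI1 {p : Fin n × Fin n | p.2 < p.1} := fun a b c hab hbc => by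
    simp only [Set.mem_ofPred_eq] at hab hbc ⊢
    exact hbc.trans hab
  exact desc.trCl_subset (fun p hp => hA p.1 p.2 hp) h

theorem CondI2Star.trCl {n : ℕ} {A : Set (Fin n × Fin n)} (hA : CondI2Star A) :
    CondI2Star (TrCl A) := by
  rintro a b c hbc hca (hab : Relation.TransGen _ a b)
  induction hab with
  | single h => exact subset_trCl A (hA _ _ _ hbc hca h)
  | @tail m b _ h ih =>
    rcases lt_trichotomy c m with hcm | rfl | hmc
    · exact subset_trCl A (hA _ _ _ hbc hcm h)
    · exact subset_trCl A h
    · exact Relation.TransGen.tail (ih hmc) h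

/-- A transitive set of descending pairs satisfying (I2) is the inversion set of the permutation
listing `Fin n` along the linear order obtained by reversing the pairs of `A`. -/
theorem isInvSet_of_condI1_condI2 {n : ℕ} {A : Set (Fin n × Fin n)}
    (hlt : ∀ a b, (a, b) ∈ A → b < a) (h1 : CondI1 A) (h2 : CondI2 A) : IsInvSet n A := by
  classical
  let R : Fin n → Fin n → Prop := fun a b => (a, b) ∈ A ∨ (a < b ∧ (b, a) ∉ A)
  have irrefl : ∀ a, ¬ R a a := by
    rintro a (h | h)
    · exact lt_irrefl _ (hlt _ _ h)
    · exact lt_irrefl _ h.1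
  have total : ∀ a b, a ≠ b → R a b ∨ R b a := by
    intro a b hab
    rcases lt_or_gt_of_ne hab with h | h <;> simp only [R] <;> tauto
  have trans : ∀ a b c, R a b → R b c → R a c := by
    rintro a b c (hab | ⟨hab, hab'⟩) (hbc | ⟨hbc, hbc'⟩)
    · exact Or.inl (h1 _ _ _ hab hbc)
    · rcases lt_trichotomy a c with h | rfl | h
      · exact Or.inr ⟨h, fun h' => hbc' (h1 _ _ _ h' hab)⟩
      · exact absurd hab hbc'
      · exact Or.inl ((h2 _ _ _ hbc h hab).resolve_right hbc')
    · rcases lt_trichotomy a c with h | rfl | h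
      · exact Or.inr ⟨h, fun h' => hab' (h1 _ _ _ hbc h')⟩
      · exact absurd hbc hab'
      · exact Or.inl ((h2 _ _ _ h hab hbc).resolve_left hab')
    · exact Or.inr ⟨hab.trans hbc, fun h => (h2 _ _ _ hab hbc h).elim hbc' hab'⟩
  let below : Fin n → Finset (Fin n) := fun a => {x | R x a}
  have card_lt : ∀ a, (below a).card < n := fun a => by
    simpa using Finset.card_lt_univ_of_notMem (s := below a) (x := a) (by simp [below, irrefl])
  let r : Fin n → Fin n := fun a => ⟨(below a).card, card_lt a⟩
  have mono : ∀ a b, R a b → r a < r b := fun a b hab => by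
    refine Fin.mk_lt_mk.2 <| Finset.card_lt_card (Finset.ssubset_iff_of_subset ?_ |>.2 ⟨a, ?_, ?_⟩)
    · intro x hx
      simp only [below, Finset.mem_filter_univ] at hx ⊢
      exact trans _ _ _ hx hab
    · simpa [below] using hab
    · simpa [below] using irrefl a
  have inj : Function.Injective r := fun a b hab => by
    by_contra hne
    rcases total a b hne with h | h
    · exact (mono _ _ h).ne hab
    · exact (mono _ _ h).ne' hab
  refine ⟨(Equiv.ofBijective r (Finite.injective_iff_bijective.1 inj)).symm, ?_⟩
  ext ⟨a, b⟩
  change (a, b) ∈ A ↔ b < a ∧ r a < r b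
  refine ⟨fun h => ⟨hlt _ _ h, mono _ _ (Or.inl h)⟩, fun ⟨hba, hr⟩ => ?_⟩
  by_contra h
  exact (mono b a (Or.inr ⟨hba, h⟩)).asymm hr

/-- The inversion sets satisfying (I2)* form a sublattice of `Sₙ`: for two such sets,
their intersection is an inversion set satisfying (I2)* and is their meet in `Sₙ`, and
the transitive closure of their union is an inversion set satisfying (I2)* and is their
join in `Sₙ`. -/
theorem stmt_14 (n : ℕ) (A B : Set (Fin n × Fin n))
    (hA : IsInvSet n A) (hB : IsInvSet n B)
    (hAs : CondI2Star A) (hBs : CondI2Star B) :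
    (IsInvSet n (A ∩ B) ∧ CondI2Star (A ∩ B) ∧
      A ∩ B ⊆ A ∧ A ∩ B ⊆ B ∧
      ∀ C : Set (Fin n × Fin n), IsInvSet n C → C ⊆ A → C ⊆ B → C ⊆ A ∩ B) ∧
    (IsInvSet n (TrCl (A ∪ B)) ∧ CondI2Star (TrCl (A ∪ B)) ∧
      A ⊆ TrCl (A ∪ B) ∧ B ⊆ TrCl (A ∪ B) ∧
      ∀ C : Set (Fin n × Fin n), IsInvSet n C → A ⊆ C → B ⊆ C → TrCl (A ∪ B) ⊆ C) := by
  have hlt : ∀ a b, (a, b) ∈ A ∪ B → b < a := fun a b h => h.elim hA.lt hB.lt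
  refine ⟨⟨?_, hAs.inter hBs, Set.inter_subset_left, Set.inter_subset_right,
    fun C _ hCA hCB => Set.subset_inter hCA hCB⟩, ?_, (hAs.union hBs).trCl,
    Set.subset_union_left.trans (subset_trCl _), Set.subset_union_right.trans (subset_trCl _),
    fun C hC hAC hBC => hC.condI1.trCl_subset (Set.union_subset hAC hBC)⟩
  · exact isInvSet_of_condI1_condI2 (fun a b h => hA.lt h.1)
      (fun a b c hab hbc => ⟨hA.condI1 a b c hab.1 hbc.1, hB.condI1 a b c hab.2 hbc.2⟩)
      (hAs.inter hBs).condI2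
  · exact isInvSet_of_condI1_condI2 (fun a b h => lt_of_mem_trCl hlt h) (condI1_trCl _)
      (hAs.union hBs).trCl.condI2
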